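/- arXiv:1301.0241 — 3 statements merged into one kernel-verified Lean document; each statement's English description precedes it below -/
import Mathlib

section
/- Let S and T be densely defined operators on a complex Hilbert space H such that T ⊂ S*S and T ⊂ SS* (note that then D(S*) ⊇ D(SS*) ⊇ D(T) is dense, so S is closable with closure S̄ = S**). Let D ⊆ D(T) be a dense linear subspace which is a core for S*S̄. Then S̄ is normal, i.e., S*S̄ = S̄S*. -/
open LinearPMap
open scoped InnerProductSpace

variable {H : Type*} [NormedAddCommGroup H] [InnerProductSpace ℂ H] [CompleteSpace H]

/-- The product `S * T` of unbounded operators, with domain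
`{x ∈ D(T) : T x ∈ D(S)}` and value `x ↦ S (T x)`. -/
noncomputable def LinearPMap.pmul (S T : H →ₗ.[ℂ] H) : H →ₗ.[ℂ] H :=
  S.comp (T.domRestrict ((Submodule.comap T.toFun S.domain).map T.domain.subtype))
    (fun x => by
      obtain ⟨y, hy, hyx⟩ := x.2.1
      have h : T.domRestrict _ x = T y := LinearPMap.domRestrict_apply hyx.symm
      rw [h]; exact hy)

/-- A densely defined closed operator `S` is normal if `S* S = S S*`
(as operators, with equal domains). -/
structure LinearPMap.IsNormalOp (S : H →ₗ.[ℂ] H) : Prop where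
  dense : Dense (S.domain : Set H)
  isClosed : S.IsClosed
  adjoint_mul_comm : S†.pmul S = S.pmul S†

set_option linter.unusedSectionVars false

namespace LinearPMap

theorem mem_graph_pmul_iff {S T : H →ₗ.[ℂ] H} {x z : H} :
    (x, z) ∈ (S.pmul T).graph ↔ ∃ y, (x, y) ∈ T.graph ∧ (y, z) ∈ S.graph := by
  constructor
  · intro h
    obtain ⟨u, rfl, rfl⟩ := (mem_graph_iff _).1 h
    obtain ⟨y, hy, hyx⟩ := u.2.1
    have e : T.domRestrict _ u = T y := domRestrict_apply hyx.symm
    refine ⟨T y, (mem_graph_iff _).2 ⟨y, hyx, rfl⟩, (mem_graph_iff _).2 ⟨⟨T y, hy⟩, rfl, ?_⟩⟩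
    change S ⟨T y, hy⟩ = S ⟨T.domRestrict _ u, _⟩
    congr 2
    exact e.symm
  · rintro ⟨y, hxy, hyz⟩
    obtain ⟨u, rfl, rfl⟩ := (mem_graph_iff _).1 hxy
    obtain ⟨v, hv, rfl⟩ := (mem_graph_iff _).1 hyz
    have hv : (v : H) = T u := hv
    have hu : T u ∈ S.domain := hv ▸ v.2
    refine (mem_graph_iff _).2 ⟨⟨u, ⟨u, hu, rfl⟩, u.2⟩, rfl, ?_⟩
    change S ⟨T.domRestrict _ _, _⟩ = S v
    congr 1
    ext
    rw [hv]
    exact domRestrict_apply rfl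

theorem pmul_mono {S S' T T' : H →ₗ.[ℂ] H} (hS : S ≤ S') (hT : T ≤ T') :
    S.pmul T ≤ S'.pmul T' := by
  refine le_of_le_graph ?_
  rintro ⟨x, z⟩ h
  obtain ⟨y, hxy, hyz⟩ := mem_graph_pmul_iff.1 h
  exact mem_graph_pmul_iff.2 ⟨y, le_graph_of_le hT hxy, le_graph_of_le hS hyz⟩

theorem graph_closure_le_topologicalClosure (T : H →ₗ.[ℂ] H) :
    T.closure.graph ≤ T.graph.topologicalClosure := by
  by_cases h : T.IsClosable
  · exact h.graph_closure_eq_closure_graph.ge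
  · rw [closure_def' h]
    exact T.graph.le_topologicalClosure

theorem mem_graph_adjoint_iff {T : H →ₗ.[ℂ] H} (hT : Dense (T.domain : Set H)) {y w : H} :
    (y, w) ∈ T†.graph ↔ ∀ a b, (a, b) ∈ T.graph → ⟪b, y⟫_ℂ = ⟪a, w⟫_ℂ := by
  rw [adjoint_graph_eq_graph_adjoint hT, Submodule.mem_adjoint_iff]
  simp only [sub_eq_zero]

theorem inner_eq_of_mem_graph_closure {T : H →ₗ.[ℂ] H} {y w : H}
    (h : ∀ a b, (a, b) ∈ T.graph → ⟪b, y⟫_ℂ = ⟪a, w⟫_ℂ) {a b : H}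
    (hab : (a, b) ∈ T.closure.graph) : ⟪b, y⟫_ℂ = ⟪a, w⟫_ℂ := by
  have hcl : _root_.IsClosed {p : H × H | ⟪p.2, y⟫_ℂ = ⟪p.1, w⟫_ℂ} :=
    isClosed_eq (by fun_prop) (by fun_prop)
  have hsub : (T.graph : Set (H × H)) ⊆ {p : H × H | ⟪p.2, y⟫_ℂ = ⟪p.1, w⟫_ℂ} :=
    fun p hp => h p.1 p.2 hp
  exact closure_minimal hsub hcl (graph_closure_le_topologicalClosure T hab)

theorem adjoint_closure {T : H →ₗ.[ℂ] H} (hT : Dense (T.domain : Set H)) :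
    T.closure† = T† := by
  have hT' : Dense (T.closure.domain : Set H) := hT.mono T.le_closure.1
  refine eq_of_eq_graph ?_
  ext ⟨y, w⟩
  rw [mem_graph_adjoint_iff hT, mem_graph_adjoint_iff hT']
  exact ⟨fun h a b hab => h a b (le_graph_of_le T.le_closure hab),
    fun h a b hab => inner_eq_of_mem_graph_closure h hab⟩

/-- The orthogonal decomposition of `H × H` along the graph of a closed operator. -/
theorem IsClosed.exists_graph_add_adjoint_graph {R : H →ₗ.[ℂ] H} (hR : R.IsClosed)
    (hd : Dense (R.domain : Set H)) (p q : H) :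
    ∃ x y z w, (x, y) ∈ R.graph ∧ (z, w) ∈ R†.graph ∧ x - w = p ∧ y + z = q := by
  let G : Submodule ℂ (WithLp 2 (H × H)) :=
    R.graph.comap (WithLp.linearEquiv 2 ℂ (H × H)).toLinearMap
  have hG : _root_.IsClosed (G : Set (WithLp 2 (H × H))) :=
    _root_.IsClosed.preimage (WithLp.prod_continuous_ofLp 2 H H) hR
  have : CompleteSpace G := hG.completeSpace_coe
  obtain ⟨g, hg, k, hk, hgk⟩ := G.exists_add_mem_mem_orthogonal (WithLp.toLp 2 (p, q))
  refine ⟨g.fst, g.snd, k.snd, -k.fst, hg, ?_, ?_, ?_⟩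
  · refine (mem_graph_adjoint_iff hd).2 fun a b hab => ?_
    have := (Submodule.mem_orthogonal _ _).1 hk (WithLp.toLp 2 (a, b)) hab
    rw [WithLp.prod_inner_apply] at this
    rw [inner_neg_right]
    exact eq_neg_of_add_eq_zero_right this
  · simpa using (congrArg WithLp.fst hgk).symm
  · simpa using (congrArg WithLp.snd hgk).symm

theorem IsClosed.exists_add_eq_adjoint_pmul_self {R : H →ₗ.[ℂ] H} (hR : R.IsClosed)
    (hd : Dense (R.domain : Set H)) (h : H) : ∃ x y, (x, y) ∈ (R†.pmul R).graph ∧ x + y = h := by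
  obtain ⟨x, y, z, w, hxy, hzw, rfl, hq⟩ := hR.exists_graph_add_adjoint_graph hd h 0
  refine ⟨x, -w, mem_graph_pmul_iff.2 ⟨y, hxy, ?_⟩, (sub_eq_add_neg x w).symm⟩
  rw [eq_neg_of_add_eq_zero_left hq]
  exact R†.graph.neg_mem hzw

theorem IsClosed.exists_add_eq_pmul_adjoint_self {R : H →ₗ.[ℂ] H} (hR : R.IsClosed)
    (hd : Dense (R.domain : Set H)) (h : H) : ∃ x y, (x, y) ∈ (R.pmul R†).graph ∧ x + y = h := by
  obtain ⟨x, y, z, w, hxy, hzw, hp, rfl⟩ := hR.exists_graph_add_adjoint_graph hd 0 h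
  obtain rfl := sub_eq_zero.1 hp
  exact ⟨z, y, mem_graph_pmul_iff.2 ⟨x, hzw, hxy⟩, add_comm z y⟩

theorem inner_adjoint_pmul_self {R : H →ₗ.[ℂ] H} (hd : Dense (R.domain : Set H)) {a b x y : H}
    (hab : (a, b) ∈ (R†.pmul R).graph) (hxy : (x, y) ∈ (R†.pmul R).graph) :
    ⟪b, x⟫_ℂ = ⟪a, y⟫_ℂ := by
  obtain ⟨c, hac, hcb⟩ := mem_graph_pmul_iff.1 hab
  obtain ⟨z, hxz, hzy⟩ := mem_graph_pmul_iff.1 hxy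
  rw [← (mem_graph_adjoint_iff hd).1 hzy a c hac, ← inner_conj_symm,
    ← (mem_graph_adjoint_iff hd).1 hcb x z hxz, inner_conj_symm]

theorem inner_pmul_adjoint_self {R : H →ₗ.[ℂ] H} (hd : Dense (R.domain : Set H)) {a b x y : H}
    (hab : (a, b) ∈ (R.pmul R†).graph) (hxy : (x, y) ∈ (R.pmul R†).graph) :
    ⟪b, x⟫_ℂ = ⟪a, y⟫_ℂ := by
  obtain ⟨c, hac, hcb⟩ := mem_graph_pmul_iff.1 hab
  obtain ⟨z, hxz, hzy⟩ := mem_graph_pmul_iff.1 hxy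
  rw [(mem_graph_adjoint_iff hd).1 hxz c b hcb, ← inner_conj_symm,
    ← (mem_graph_adjoint_iff hd).1 hac z y hzy, inner_conj_symm]

/-- If `B` is symmetric and `1 + B` is onto, then `B` contains every formal adjoint of `B`. -/
theorem mem_graph_of_symmetric_of_surjective {B : H →ₗ.[ℂ] H}
    (hsymm : ∀ a b x y, (a, b) ∈ B.graph → (x, y) ∈ B.graph → ⟪b, x⟫_ℂ = ⟪a, y⟫_ℂ)
    (hsurj : ∀ h, ∃ x y, (x, y) ∈ B.graph ∧ x + y = h) {x y : H}
    (hxy : ∀ a b, (a, b) ∈ B.graph → ⟪b, x⟫_ℂ = ⟪a, y⟫_ℂ) : (x, y) ∈ B.graph := by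
  obtain ⟨u, v, huv, h⟩ := hsurj (x + y)
  obtain ⟨a, b, hab, hxu⟩ := hsurj (x - u)
  have key : ⟪a + b, x - u⟫_ℂ = 0 := by
    have e : ⟪a, u⟫_ℂ + ⟪a, v⟫_ℂ = ⟪a, x⟫_ℂ + ⟪a, y⟫_ℂ := by
      rw [← inner_add_right, ← inner_add_right, h]
    rw [inner_add_left, inner_sub_right, inner_sub_right, hxy a b hab, hsymm a b u v hab huv]
    linear_combination -e
  rw [hxu, inner_self_eq_zero, sub_eq_zero] at key
  subst key
  rwa [← add_left_cancel h]

end LinearPMap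

theorem statement2 (S T : H →ₗ.[ℂ] H)
    (hSdense : Dense (S.domain : Set H)) (hTdense : Dense (T.domain : Set H))
    (h1 : T ≤ S†.pmul S) (h2 : T ≤ S.pmul S†)
    (D : Submodule ℂ H) (hD : D ≤ T.domain) (hDdense : Dense (D : Set H))
    (hcore : (S†.pmul S.closure).HasCore D) :
    S†.pmul S.closure = S.closure.pmul S† := by
  have hadj : Dense (S†.domain : Set H) := by
    refine hTdense.mono fun x hx => ?_
    obtain ⟨y, hxy⟩ := mem_domain_iff.1 (h2.1 hx)
    obtain ⟨z, hxz, -⟩ := mem_graph_pmul_iff.1 hxy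
    exact mem_domain_of_mem_graph hxz
  have hclosable : S.IsClosable := isClosable_iff_exists_closed_extension.2
    ⟨S††, adjoint_isClosed hadj,
      (adjoint_isFormalAdjoint hSdense).le_adjoint hadj⟩
  have hcl : S.closure.IsClosed := hclosable.closure_isClosed
  have hd : Dense (S.closure.domain : Set H) := hSdense.mono S.le_closure.1
  have hTA : T ≤ S†.pmul S.closure := h1.trans (pmul_mono le_rfl S.le_closure)
  have hTB : T ≤ S.closure.pmul S† := h2.trans (pmul_mono S.le_closure le_rfl)
  rw [← adjoint_closure hSdense] at hTA hTB hcore ⊢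
  set R := S.closure
  have hAB : (R†.pmul R).graph ≤ (R.pmul R†).graph := by
    rintro ⟨x, y⟩ hxy
    refine mem_graph_of_symmetric_of_surjective
      (fun _ _ _ _ => inner_pmul_adjoint_self hd) (hcl.exists_add_eq_pmul_adjoint_self hd)
      fun a b hab => ?_
    rw [← hcore.closure_eq] at hxy
    rw [← inner_conj_symm, ← inner_conj_symm a]
    refine congrArg _ (inner_eq_of_mem_graph_closure (fun c d hcd => ?_) hxy).symm
    have hc : c ∈ T.domain := hD (mem_domain_of_mem_graph hcd).1
    have hcT : (c, T ⟨c, hc⟩) ∈ T.graph := T.mem_graph ⟨c, hc⟩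
    rw [mem_graph_snd_inj _ (le_graph_of_le domRestrict_le hcd) (le_graph_of_le hTA hcT) rfl]
    exact inner_pmul_adjoint_self hd (le_graph_of_le hTB hcT) hab
  refine eq_of_eq_graph (hAB.antisymm ?_)
  rintro ⟨x, y⟩ hxy
  exact mem_graph_of_symmetric_of_surjective
    (fun _ _ _ _ => inner_adjoint_pmul_self hd) (hcl.exists_add_eq_adjoint_pmul_self hd)
    fun a b hab => inner_pmul_adjoint_self hd (hAB hab) hxy
end

section
/- Let A₁, …, Aₙ be densely defined symmetric operators on a complex Hilbert space H, and let D be a dense linear subspace contained in D((A₁+⋯+Aₙ)²), where A₁+⋯+Aₙ has domain D(A₁) ∩ ⋯ ∩ D(Aₙ). If D is a core for (A₁+⋯+Aₙ)* (A₁+⋯+Aₙ)‾ (the product of the adjoint of the sum with the closure of the sum), then A₁+⋯+Aₙ is essentially self-adjoint, i.e., the closure of A₁+⋯+Aₙ is self-adjoint. -/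
open LinearPMap
open scoped InnerProductSpace

variable {H : Type*} [NormedAddCommGroup H] [InnerProductSpace ℂ H] [CompleteSpace H]

section

variable {E : Type*} [NormedAddCommGroup E] [InnerProductSpace ℂ E]

theorem Submodule.adjoint_topologicalClosure (g : Submodule ℂ (E × E)) :
    g.topologicalClosure.adjoint = g.adjoint := by
  ext x
  simp only [Submodule.mem_adjoint_iff]
  refine ⟨fun h a b hab => h a b (g.le_topologicalClosure hab), fun h a b hab => ?_⟩
  have hcl : _root_.IsClosed {p : E × E | inner ℂ p.2 x.1 - inner ℂ p.1 x.2 = 0} :=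
    isClosed_eq (by fun_prop) continuous_const
  exact closure_minimal (s := (g : Set (E × E))) (fun p hp => h p.1 p.2 hp) hcl hab

namespace LinearPMap

theorem IsFormalAdjoint.zero : (0 : E →ₗ.[ℂ] E).IsFormalAdjoint 0 :=
  fun _ _ => (inner_zero_left _).trans (inner_zero_right _).symm

theorem IsFormalAdjoint.add {S S' T T' : E →ₗ.[ℂ] E} (h : S.IsFormalAdjoint T)
    (h' : S'.IsFormalAdjoint T') : (S + S').IsFormalAdjoint (T + T') := fun x y => by
  rw [add_apply, add_apply, inner_add_left, inner_add_right]
  exact congrArg₂ (· + ·) (h ⟨x, x.2.1⟩ ⟨y, y.2.1⟩) (h' ⟨x, x.2.2⟩ ⟨y, y.2.2⟩)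

theorem isFormalAdjoint_self_of_le_adjoint {T : H →ₗ.[ℂ] H} (hT : Dense (T.domain : Set H))
    (h : T ≤ T†) : T.IsFormalAdjoint T := fun x y => by
  rw [h.2 (y := ⟨x, h.1 x.2⟩) rfl]
  exact adjoint_isFormalAdjoint hT ⟨x, h.1 x.2⟩ y

theorem graph_closure_le (T : E →ₗ.[ℂ] E) : T.closure.graph ≤ T.graph.topologicalClosure := by
  by_cases h : T.IsClosable
  · exact h.graph_closure_eq_closure_graph.ge
  · rw [closure_def' h]
    exact T.graph.le_topologicalClosure

theorem mem_graph_pmul {S T : E →ₗ.[ℂ] E} {x z : E} :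
    (x, z) ∈ (S.pmul T).graph ↔ ∃ y, (x, y) ∈ T.graph ∧ (y, z) ∈ S.graph := by
  have key : ∀ (u : (S.pmul T).domain) (v : T.domain), (u : E) = v →
      (T v, S.pmul T u) ∈ S.graph := by
    intro u v huv
    have h : T.domRestrict _ u = T v := domRestrict_apply huv
    rw [← h]
    exact S.mem_graph ⟨_, _⟩
  constructor
  · rw [mem_graph_iff]
    rintro ⟨u, rfl, rfl⟩
    exact ⟨T ⟨u, u.2.2⟩, T.mem_graph ⟨u, u.2.2⟩, key u _ rfl⟩
  · rintro ⟨y, hxy, hyz⟩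
    obtain ⟨v, rfl, rfl⟩ := T.mem_graph_iff.mp hxy
    have hv : (v : E) ∈ (S.pmul T).domain :=
      ⟨Submodule.mem_map.mpr ⟨v, mem_domain_of_mem_graph hyz, rfl⟩, v.2⟩
    rw [S.mem_graph_snd_inj hyz (key ⟨v, hv⟩ v rfl) rfl]
    exact mem_graph (S.pmul T) ⟨v, hv⟩

/-- The range of `T - c`. -/
noncomputable def rangeSubSMul (T : E →ₗ.[ℂ] E) (c : ℂ) : Submodule ℂ E :=
  T.graph.map (LinearMap.snd ℂ E E - c • LinearMap.fst ℂ E E)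

theorem mem_rangeSubSMul {T : E →ₗ.[ℂ] E} {c : ℂ} {z : E} :
    z ∈ T.rangeSubSMul c ↔ ∃ x y, (x, y) ∈ T.graph ∧ y - c • x = z := by
  simp only [rangeSubSMul, Submodule.mem_map, Prod.exists]
  rfl

theorem norm_sub_smul_sq {x y : E} (h : inner ℂ y x = inner ℂ x y) {c : ℂ} (hc : c.re = 0) :
    ‖y - c • x‖ ^ 2 = ‖y‖ ^ 2 + ‖c‖ ^ 2 * ‖x‖ ^ 2 := by
  have him : (inner ℂ y x).im = 0 := by
    have := congrArg Complex.im (inner_conj_symm (𝕜 := ℂ) x y)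
    rw [← h, Complex.conj_im] at this
    linarith
  rw [norm_sub_sq (𝕜 := ℂ), inner_smul_right, norm_smul]
  simp [hc, him, mul_pow]

theorem isClosed_rangeSubSMul {T : H →ₗ.[ℂ] H} (hT : T.IsClosed)
    (hsymm : T.graph ≤ T.graph.adjoint) {c : ℂ} (hc : c.re = 0) (hc' : ‖c‖ = 1) :
    _root_.IsClosed (T.rangeSubSMul c : Set H) := by
  let L : T.graph →L[ℂ] H :=
    (ContinuousLinearMap.snd ℂ H H - c • ContinuousLinearMap.fst ℂ H H).comp T.graph.subtypeL
  have hL : AntilipschitzWith 1 L := by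
    refine L.antilipschitz_of_bound fun p => ?_
    have hs := (Submodule.mem_adjoint_iff _ _).mp (hsymm p.2) p.1.1 p.1.2 p.2
    have h := norm_sub_smul_sq (sub_eq_zero.mp hs) hc
    have hLp : L p = p.1.2 - c • p.1.1 := rfl
    rw [hc'] at h
    rw [NNReal.coe_one, one_mul, hLp, Submodule.coe_norm, Prod.norm_def]
    refine max_le ?_ ?_ <;> refine le_of_sq_le_sq ?_ (norm_nonneg _) <;> rw [h] <;>
      nlinarith [sq_nonneg ‖p.1.1‖, sq_nonneg ‖p.1.2‖]
  have : CompleteSpace T.graph := IsClosed.completeSpace_coe (hs := hT)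
  convert hL.isClosed_range L.uniformContinuous
  ext z
  simp only [SetLike.mem_coe, mem_rangeSubSMul, Set.mem_range, Subtype.exists, Prod.exists]
  exact ⟨fun ⟨x, y, h, e⟩ => ⟨x, y, h, e⟩, fun ⟨x, y, h, e⟩ => ⟨x, y, h, e⟩⟩

/-- The basic criterion for self-adjointness. -/
theorem isSelfAdjoint_of_dense_rangeSubSMul {T : H →ₗ.[ℂ] H} (hdense : Dense (T.domain : Set H))
    (hT : T.IsClosed) (hsymm : T.graph ≤ T.graph.adjoint)
    (hI : Dense (T.rangeSubSMul Complex.I : Set H))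
    (hI' : Dense (T.rangeSubSMul (-Complex.I) : Set H)) : IsSelfAdjoint T := by
  rw [isSelfAdjoint_def]
  refine eq_of_eq_graph ?_
  rw [adjoint_graph_eq_graph_adjoint hdense]
  refine le_antisymm ?_ hsymm
  rintro ⟨y, z⟩ hyz
  have hmem : z - Complex.I • y ∈ T.rangeSubSMul Complex.I := by
    have hcl := isClosed_rangeSubSMul hT hsymm (c := Complex.I) (by simp) (by simp)
    rw [← SetLike.mem_coe, ← hcl.closure_eq, hI.closure_eq]
    trivial
  obtain ⟨x, w, hxw, he⟩ := mem_rangeSubSMul.mp hmem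
  have hd : z - w = Complex.I • (y - x) := by
    linear_combination (norm := module) -he
  have hyx : y - x = 0 := by
    refine hI'.eq_zero_of_inner_right ℂ fun v hv => ?_
    obtain ⟨a, b, hab, rfl⟩ := mem_rangeSubSMul.mp hv
    have h := (Submodule.mem_adjoint_iff _ _).mp (sub_mem hyz (hsymm hxw)) a b hab
    simp only [Prod.mk_sub_mk, hd, inner_smul_right] at h
    rw [inner_sub_left, inner_smul_left]
    simpa using h
  rw [hyx, smul_zero] at hd
  rwa [sub_eq_zero.mp hyx, sub_eq_zero.mp hd]

/-- `1 + T* T̄` is surjective. -/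
theorem exists_mem_graph_adjoint_pmul_closure {T : H →ₗ.[ℂ] H} (hdense : Dense (T.domain : Set H))
    (hT : T.IsClosable) (h : H) : ∃ x, (x, h - x) ∈ (T†.pmul T.closure).graph := by
  let e := WithLp.linearEquiv 2 ℂ (H × H)
  let K : Submodule ℂ (WithLp 2 (H × H)) := T.closure.graph.comap e.toLinearMap
  have hK : _root_.IsClosed (K : Set (WithLp 2 (H × H))) :=
    hT.closure_isClosed.preimage (WithLp.prod_continuous_ofLp 2 H H)
  have : CompleteSpace K := hK.completeSpace_coe
  obtain ⟨p, hp, q, hq, hpq⟩ := K.exists_add_mem_mem_orthogonal (e.symm (h, 0))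
  have h1 : h = p.fst + q.fst := congrArg (fun u => (e u).1) hpq
  have h2 : 0 = p.snd + q.snd := congrArg (fun u => (e u).2) hpq
  refine ⟨p.fst, mem_graph_pmul.mpr ⟨p.snd, hp, ?_⟩⟩
  rw [adjoint_graph_eq_graph_adjoint hdense, Submodule.mem_adjoint_iff]
  intro a b hab
  have hK' : e.symm (a, b) ∈ K := le_graph_of_le T.le_closure hab
  have horth := K.mem_orthogonal q |>.mp hq _ hK'
  rw [WithLp.prod_inner_apply] at horth
  change inner ℂ a q.fst + inner ℂ b q.snd = 0 at horth
  rw [h1, add_sub_cancel_left]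
  rw [eq_neg_of_add_eq_zero_left h2.symm, inner_neg_right, ← neg_add', add_comm, horth, neg_zero]

theorem dense_rangeSubSMul_of_hasCore {S : H →ₗ.[ℂ] H} (hdense : Dense (S.domain : Set H))
    (hS : S.IsClosable) (hsymm : S ≤ S†) {D : Submodule ℂ H} (hD : D ≤ (S.pmul S).domain)
    (hcore : (S†.pmul S.closure).HasCore D) {c : ℂ} (hc : c ^ 2 = -1) :
    Dense (S.rangeSubSMul c : Set H) := by
  intro h
  obtain ⟨x, hx⟩ := exists_mem_graph_adjoint_pmul_closure hdense hS h
  rw [← hcore.closure_eq] at hx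
  have hx' := graph_closure_le _ hx
  have hcont : Continuous fun p : H × H => p.1 + p.2 := by fun_prop
  suffices hsum : x + (h - x) ∈ _root_.closure (S.rangeSubSMul c : Set H) by
    rwa [add_sub_cancel] at hsum
  refine map_mem_closure (f := fun p : H × H => p.1 + p.2) hcont hx' ?_
  rintro ⟨d, z⟩ hdz
  have hdD := (mem_domain_of_mem_graph hdz).1
  obtain ⟨w, hw⟩ := mem_domain_iff.mp (hD hdD)
  obtain ⟨y, hdy, hyw⟩ := mem_graph_pmul.mp hw
  have hdw : (d, w) ∈ (S†.pmul S.closure).graph :=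
    mem_graph_pmul.mpr ⟨y, le_graph_of_le S.le_closure hdy, le_graph_of_le hsymm hyw⟩
  obtain rfl : z = w := mem_graph_snd_inj _ (le_graph_of_le domRestrict_le hdz) hdw rfl
  refine mem_rangeSubSMul.mpr ⟨y + c • d, z + c • y, add_mem hyw (S.graph.smul_mem c hdy), ?_⟩
  rw [smul_add, smul_smul, ← sq, hc]
  module

end LinearPMap

end

theorem statement7 (n : ℕ) (A : Fin n → (H →ₗ.[ℂ] H))
    (hdense : ∀ i, Dense ((A i).domain : Set H))
    (hsymm : ∀ i, A i ≤ (A i)†)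
    (D : Submodule ℂ H) (hDdense : Dense (D : Set H))
    (hD : D ≤ ((∑ i, A i).pmul (∑ i, A i)).domain)
    (hcore : ((∑ i, A i)†.pmul (∑ i, A i).closure).HasCore D) :
    (∑ i, A i).IsClosable ∧ IsSelfAdjoint (∑ i, A i).closure := by
  have hDS : D ≤ (∑ i, A i).domain := hD.trans inf_le_right
  have hS : Dense ((∑ i, A i).domain : Set H) := hDdense.mono hDS
  have hself : (∑ i, A i).IsFormalAdjoint (∑ i, A i) :=
    Finset.sum_induction A (fun T => T.IsFormalAdjoint T) (fun _ _ => .add) .zero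
      fun i _ => isFormalAdjoint_self_of_le_adjoint (hdense i) (hsymm i)
  have hle := hself.le_adjoint hS
  have hclosable : (∑ i, A i).IsClosable :=
    (adjoint_isClosed hS).isClosable.leIsClosable hle
  have hsub := (∑ i, A i).le_closure
  have hrange (c : ℂ) (hc : c ^ 2 = -1) : Dense ((∑ i, A i).closure.rangeSubSMul c : Set H) :=
    (dense_rangeSubSMul_of_hasCore hS hclosable hle hD hcore hc).mono
      (Submodule.map_mono (le_graph_of_le hsub))
  refine ⟨hclosable, isSelfAdjoint_of_dense_rangeSubSMul (hS.mono hsub.1)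
    hclosable.closure_isClosed ?_ (hrange _ (by simp)) (hrange _ (by simp))⟩
  rw [← hclosable.graph_closure_eq_closure_graph, Submodule.adjoint_topologicalClosure,
    ← adjoint_graph_eq_graph_adjoint hS]
  exact Submodule.topologicalClosure_minimal _ (le_graph_of_le hle) (adjoint_isClosed hS)
end

section
/- Let A be a densely defined normal operator on a complex Hilbert space H and let B be an everywhere-defined bounded normal operator on H. If BA* ⊂ −AB* (for every x ∈ D(A*): B*x ∈ D(A) and BA*x = −AB*x) and B*A ⊂ −A*B (for every x ∈ D(A): Bx ∈ D(A*) and B*Ax = −A*Bx), then A+B, with domain D(A), is normal: (A+B)*(A+B) = (A+B)(A+B)*. -/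
open LinearPMap
open scoped InnerProductSpace

variable {H : Type*} [NormedAddCommGroup H] [InnerProductSpace ℂ H] [CompleteSpace H]

omit [CompleteSpace H] in
theorem LinearPMap.mem_graph_pmul_iff_s14 (S T : H →ₗ.[ℂ] H) (x z : H) :
    (x, z) ∈ (S.pmul T).graph ↔ ∃ y, (x, y) ∈ T.graph ∧ (y, z) ∈ S.graph := by
  simp only [LinearPMap.mem_graph_iff]
  constructor
  · rintro ⟨⟨w, hw⟩, rfl, rfl⟩
    obtain ⟨y, hy, rfl⟩ := hw.1
    refine ⟨T y, ⟨y, rfl, rfl⟩, ⟨T y, hy⟩, rfl, ?_⟩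
    exact congrArg S (Subtype.ext (LinearPMap.domRestrict_apply rfl).symm)
  · rintro ⟨_, ⟨x, rfl, rfl⟩, w, hw, rfl⟩
    have hx : T x ∈ S.domain := hw ▸ w.2
    refine ⟨⟨x, ⟨x, hx, rfl⟩, x.2⟩, rfl, ?_⟩
    exact congrArg S (Subtype.ext ((LinearPMap.domRestrict_apply rfl).trans hw.symm))

omit [CompleteSpace H] in
theorem LinearPMap.mem_graph_add_toPMap_iff (A : H →ₗ.[ℂ] H) (B : H →L[ℂ] H) (x y : H) :
    (x, y) ∈ (A + (B : H →ₗ[ℂ] H).toPMap ⊤).graph ↔ (x, y - B x) ∈ A.graph := by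
  simp only [LinearPMap.mem_graph_iff]
  constructor
  · rintro ⟨w, rfl, rfl⟩
    refine ⟨⟨w, w.2.1⟩, rfl, ?_⟩
    rw [LinearPMap.add_apply]
    exact (add_sub_cancel_right _ _).symm
  · rintro ⟨x, rfl, h⟩
    refine ⟨⟨x, x.2, trivial⟩, rfl, ?_⟩
    rw [LinearPMap.add_apply]
    exact (eq_sub_iff_add_eq.mp h)

theorem LinearPMap.mem_graph_adjoint_iff_s14 {T : H →ₗ.[ℂ] H} (hT : Dense (T.domain : Set H))
    (x z : H) :
    (x, z) ∈ T†.graph ↔ ∀ a b, (a, b) ∈ T.graph → ⟪b, x⟫_ℂ = ⟪a, z⟫_ℂ := by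
  rw [LinearPMap.adjoint_graph_eq_graph_adjoint hT, Submodule.mem_adjoint_iff]
  simp only [sub_eq_zero]

theorem LinearPMap.mem_graph_adjoint_add_toPMap_iff {A : H →ₗ.[ℂ] H}
    (hA : Dense (A.domain : Set H)) (B : H →L[ℂ] H) (x z : H) :
    (x, z) ∈ (A + (B : H →ₗ[ℂ] H).toPMap ⊤)†.graph ↔
      (x, z - ContinuousLinearMap.adjoint B x) ∈ A†.graph := by
  have hd : Dense ((A + (B : H →ₗ[ℂ] H).toPMap ⊤).domain : Set H) := by
    have h : (A + (B : H →ₗ[ℂ] H).toPMap ⊤).domain = A.domain := inf_top_eq _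
    rwa [h]
  rw [mem_graph_adjoint_iff_s14 hd, mem_graph_adjoint_iff_s14 hA]
  simp only [mem_graph_add_toPMap_iff, inner_sub_right, ContinuousLinearMap.adjoint_inner_right]
  constructor
  · intro h a b hab
    have := h a (b + B a) (by simpa using hab)
    rw [inner_add_left] at this
    exact eq_sub_of_add_eq this
  · intro h a b hab
    have := h a _ hab
    rw [inner_sub_left] at this
    exact sub_left_injective this

theorem statement14 (A : H →ₗ.[ℂ] H) (hA : A.IsNormalOp)
    (B : H →L[ℂ] H)
    (hBnormal : B ∘L ContinuousLinearMap.adjoint B = ContinuousLinearMap.adjoint B ∘L B)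
    (hanti1 : ∀ x : A†.domain, ∃ h : ContinuousLinearMap.adjoint B (x : H) ∈ A.domain,
      B (A† x) = - A ⟨ContinuousLinearMap.adjoint B (x : H), h⟩)
    (hanti2 : ∀ x : A.domain, ∃ h : B (x : H) ∈ A†.domain,
      ContinuousLinearMap.adjoint B (A x) = - A† ⟨B (x : H), h⟩) :
    (A + (B : H →ₗ[ℂ] H).toPMap ⊤)†.pmul (A + (B : H →ₗ[ℂ] H).toPMap ⊤) =
      (A + (B : H →ₗ[ℂ] H).toPMap ⊤).pmul (A + (B : H →ₗ[ℂ] H).toPMap ⊤)† := by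
  have hB (x : H) : B (ContinuousLinearMap.adjoint B x) = ContinuousLinearMap.adjoint B (B x) :=
    DFunLike.congr_fun hBnormal x
  have h1 {x y : H} (h : (x, y) ∈ A†.graph) :
      (ContinuousLinearMap.adjoint B x, -B y) ∈ A.graph := by
    obtain ⟨x, rfl, rfl⟩ := (LinearPMap.mem_graph_iff _).mp h
    obtain ⟨hx, e⟩ := hanti1 x
    exact (LinearPMap.mem_graph_iff _).mpr ⟨⟨_, hx⟩, rfl, by rw [e, neg_neg]⟩
  have h2 {x y : H} (h : (x, y) ∈ A.graph) :
      (B x, -ContinuousLinearMap.adjoint B y) ∈ A†.graph := by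
    obtain ⟨x, rfl, rfl⟩ := (LinearPMap.mem_graph_iff _).mp h
    obtain ⟨hx, e⟩ := hanti2 x
    exact (LinearPMap.mem_graph_iff _).mpr ⟨⟨_, hx⟩, rfl, by rw [e, neg_neg]⟩
  have left (x z : H) : (x, z) ∈ ((A + (B : H →ₗ[ℂ] H).toPMap ⊤)†.pmul
      (A + (B : H →ₗ[ℂ] H).toPMap ⊤)).graph ↔
      (x, z - ContinuousLinearMap.adjoint B (B x)) ∈ (A†.pmul A).graph := by
    simp only [LinearPMap.mem_graph_pmul_iff_s14, LinearPMap.mem_graph_add_toPMap_iff,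
      LinearPMap.mem_graph_adjoint_add_toPMap_iff hA.dense]
    constructor
    · rintro ⟨y, hy, hz⟩
      refine ⟨y - B x, hy, ?_⟩
      convert A†.graph.sub_mem hz (h2 hy) using 1
      simp only [Prod.mk_sub_mk, _root_.map_sub]
      congr 1
      abel
    · rintro ⟨y, hy, hz⟩
      refine ⟨y + B x, by simpa using hy, ?_⟩
      convert A†.graph.add_mem hz (h2 hy) using 1
      simp only [Prod.mk_add_mk, _root_.map_add]
      congr 1
      abel
  have right (x z : H) : (x, z) ∈ ((A + (B : H →ₗ[ℂ] H).toPMap ⊤).pmul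
      (A + (B : H →ₗ[ℂ] H).toPMap ⊤)†).graph ↔
      (x, z - ContinuousLinearMap.adjoint B (B x)) ∈ (A.pmul A†).graph := by
    simp only [LinearPMap.mem_graph_pmul_iff_s14, LinearPMap.mem_graph_add_toPMap_iff,
      LinearPMap.mem_graph_adjoint_add_toPMap_iff hA.dense, ← hB]
    constructor
    · rintro ⟨y, hy, hz⟩
      refine ⟨y - ContinuousLinearMap.adjoint B x, hy, ?_⟩
      convert A.graph.sub_mem hz (h1 hy) using 1
      simp only [Prod.mk_sub_mk, _root_.map_sub]
      congr 1
      abel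
    · rintro ⟨y, hy, hz⟩
      refine ⟨y + ContinuousLinearMap.adjoint B x, by simpa using hy, ?_⟩
      convert A.graph.add_mem hz (h1 hy) using 1
      simp only [Prod.mk_add_mk, _root_.map_add]
      congr 1
      abel
  refine LinearPMap.eq_of_eq_graph (Submodule.ext fun ⟨x, z⟩ => ?_)
  rw [left, right, hA.adjoint_mul_comm]
end
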